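/- Let k ≥ 1 be an integer, let p and γ be real numbers with 1 ≤ p < ∞ and γ < k, let R > 0, and let ψ be a nonnegative C¹ function defined on an open neighborhood of the closed ball B̄(0,R) ⊂ ℝᵏ. Then ((k−γ)/p)^p · ∫_{B(0,R)} ψ(x)^p ‖x‖^{−γ} dx ≤ ∫_{B(0,R)} ‖∇ψ(x)‖^p ‖x‖^{p−γ} dx + ((k−γ)/p)^{p−1} · R^{1−γ} · ∫_{S_R} ψ(x)^p dμH^{k−1}(x), where S_R = {x ∈ ℝᵏ : ‖x‖ = R}. Moreover, if p > 1, equality holds if and only if ψ ≡ 0 on B̄(0,R). -/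

import Mathlib

open MeasureTheory Metric Real

section

open scoped Pointwise ENNReal

/-- The central projection `y ↦ ⟪e, y⟫ / ⟪x, y⟫` onto the tangent hyperplane at a unit vector `x`
is Lipschitz near `x`, with a constant close to `1`. -/
theorem abs_inner_div_inner_sub_le {E : Type*} [NormedAddCommGroup E] [InnerProductSpace ℝ E]
    {ε d : ℝ} (hε0 : 0 ≤ ε) (hε : ε < 1) {x e y z : E} (hx : ‖x‖ = 1) (he : ‖e‖ = 1)
    (hex : inner ℝ e x = 0) (hy : dist y x ≤ ε) (hz : dist z x ≤ ε) (hyz : dist y z ≤ d) :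
    |inner ℝ e y / inner ℝ x y - inner ℝ e z / inner ℝ x z| ≤
      (1 / (1 - ε) + ε / (1 - ε) ^ 2) * d := by
  have low : ∀ w : E, dist w x ≤ ε → 1 - ε ≤ inner ℝ x w := by
    intro w hw
    have h1 : inner ℝ x w = 1 + inner ℝ x (w - x) := by
      rw [inner_sub_right, real_inner_self_eq_norm_sq, hx]; ring
    have h2 := abs_real_inner_le_norm x (w - x)
    rw [hx, one_mul, ← dist_eq_norm] at h2
    have := (abs_le.1 h2).1
    linarith
  have hy0 := low y hy
  have hz0 := low z hz
  have m0 : 0 < 1 - ε := by linarith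
  have hez : |inner ℝ e z| ≤ ε := by
    have h1 : inner ℝ e z = inner ℝ e (z - x) := by rw [inner_sub_right, hex, sub_zero]
    have h2 := abs_real_inner_le_norm e (z - x)
    rw [he, one_mul, ← dist_eq_norm] at h2
    rw [h1]; exact h2.trans hz
  have h1 : |inner ℝ e y - inner ℝ e z| ≤ d := by
    rw [← inner_sub_right]
    refine (abs_real_inner_le_norm _ _).trans ?_
    rw [he, one_mul, ← dist_eq_norm]; exact hyz
  have h2 : |inner ℝ x z - inner ℝ x y| ≤ d := by
    rw [← inner_sub_right]
    refine (abs_real_inner_le_norm _ _).trans ?_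
    rw [hx, one_mul, ← dist_eq_norm, dist_comm]; exact hyz
  have hd : 0 ≤ d := dist_nonneg.trans hyz
  have hyp : 0 < inner ℝ x y := m0.trans_le hy0
  have hzp : 0 < inner ℝ x z := m0.trans_le hz0
  have key : inner ℝ e y / inner ℝ x y - inner ℝ e z / inner ℝ x z
      = (inner ℝ e y - inner ℝ e z) / inner ℝ x y
        + inner ℝ e z * (inner ℝ x z - inner ℝ x y) / (inner ℝ x y * inner ℝ x z) := by
    field_simp; ring
  rw [key, add_mul]
  refine (abs_add_le _ _).trans (add_le_add ?_ ?_)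
  · rw [abs_div, abs_of_pos hyp, one_div_mul_eq_div]
    gcongr
  · rw [abs_div, abs_of_pos (mul_pos hyp hzp), abs_mul, div_mul_eq_mul_div, sq]
    gcongr

/-- The surface measure of a small subset of the unit sphere is at most its diameter to the power
`n`, up to a factor close to `1`. -/
theorem toSphere_le_of_ediam_le {n : ℕ} {ε : ℝ} (hε0 : 0 < ε) (hε : ε < 1)
    (s : Set (sphere (0 : EuclideanSpace ℝ (Fin (n + 1))) 1))
    (hs : ediam s ≤ ENNReal.ofReal ε) :
    (volume : Measure (EuclideanSpace ℝ (Fin (n + 1)))).toSphere s ≤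
      (ENNReal.ofReal (1 / (1 - ε) + ε / (1 - ε) ^ 2) * ediam s) ^ n := by
  wlog hcl : IsClosed s generalizing s
  · have := this (closure s) (by rwa [ediam_closure]) isClosed_closure
    rw [ediam_closure] at this
    exact (measure_mono subset_closure).trans this
  rcases s.eq_empty_or_nonempty with rfl | ⟨x, hxs⟩
  · simp
  have hx : ‖(x : EuclideanSpace ℝ (Fin (n + 1)))‖ = 1 := by simp
  set L : ℝ := 1 / (1 - ε) + ε / (1 - ε) ^ 2 with hL
  have m0 : 0 < 1 - ε := by linarith
  have hL0 : 0 ≤ L := by positivity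
  have hfin : ediam s ≠ ⊤ := ne_top_of_le_ne_top ENNReal.ofReal_ne_top hs
  set d : ℝ := (ediam s).toReal with hd
  have hd0 : 0 ≤ d := ENNReal.toReal_nonneg
  have hdle : d ≤ ε := ENNReal.toReal_le_of_le_ofReal hε0.le hs
  have hdist : ∀ y ∈ s, ∀ z ∈ s,
      dist (y : EuclideanSpace ℝ (Fin (n + 1))) (z : EuclideanSpace ℝ (Fin (n + 1))) ≤ d := by
    intro y hy z hz
    rw [← Subtype.dist_eq, dist_edist]
    exact ENNReal.toReal_mono hfin (edist_le_ediam_of_mem hy hz)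
  obtain ⟨b, hb⟩ := Orthonormal.exists_orthonormalBasis_extension_of_card_eq (𝕜 := ℝ)
    (ι := Fin (n + 1)) (E := EuclideanSpace ℝ (Fin (n + 1))) (by simp)
    (v := fun _ => (x : EuclideanSpace ℝ (Fin (n + 1)))) (s := {0}) (by
      constructor
      · intro i; simp
      · intro i j hij
        exact absurd (Subsingleton.elim i j) hij)
  have hb0 : b 0 = x := hb 0 rfl
  have hbs : ∀ i : Fin n, inner ℝ (b i.succ) (x : EuclideanSpace ℝ (Fin (n + 1))) = 0 := by
    intro i
    rw [← hb0]
    exact b.orthonormal.2 (Fin.succ_ne_zero i)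
  set C : Set (EuclideanSpace ℝ (Fin (n + 1))) := Set.Ioo (0 : ℝ) 1 • ((↑) '' s) with hC
  have hCm : MeasurableSet C := by
    have hCeq : C = (↑) '' (homeomorphUnitSphereProd (EuclideanSpace ℝ (Fin (n + 1))) ⁻¹'
        s ×ˢ Set.Iio ⟨1, Set.mem_Ioi.2 one_pos⟩) := by
      rw [hC, ← Set.image2_smul, Set.image2_image_right, ← Homeomorph.image_symm, Set.image_image]
      have : Set.Ioo (0 : ℝ) 1 = (↑) '' (Set.Iio (⟨1, Set.mem_Ioi.2 one_pos⟩ : Set.Ioi (0 : ℝ))) := by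
        rw [Set.image_subtype_val_Ioi_Iio]
      rw [this, Set.image2_image_left, Set.image2_swap, ← Set.image_prod]
      rfl
    rw [hCeq]
    refine MeasurableSet.subtype_image (measurableSet_singleton _).compl ?_
    exact (homeomorphUnitSphereProd _).measurable (hcl.measurableSet.prod measurableSet_Iio)
  set Φ := (b.measurableEquiv.trans (MeasurableEquiv.toLp 2 (Fin (n + 1) → ℝ)).symm).trans
    (MeasurableEquiv.piFinSuccAbove (fun _ => ℝ) 0) with hΦ
  have hΦm : MeasurePreserving Φ := by
    exact (b.measurePreserving_measurableEquiv.trans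
      (EuclideanSpace.volume_preserving_symm_measurableEquiv_toLp _)).trans
      (volume_preserving_piFinSuccAbove (fun _ => ℝ) 0)
  have hΦ1 : ∀ y, (Φ y).1 = inner ℝ (x : EuclideanSpace ℝ (Fin (n + 1))) y := by
    intro y
    rw [← hb0, ← b.repr_apply_apply]; rfl
  have hΦ2 : ∀ y i, (Φ y).2 i = inner ℝ (b i.succ) y := by
    intro y i
    rw [← b.repr_apply_apply]; rfl
  have hvol : volume C = ∫⁻ t, volume (Prod.mk t ⁻¹' (Φ.symm ⁻¹' C)) := by
    rw [← hΦm.symm.measure_preimage_equiv, Measure.volume_eq_prod,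
      Measure.prod_apply (Φ.symm.measurable hCm)]
  have hmem : ∀ t v, (t, v) ∈ Φ.symm ⁻¹' C → ∃ y ∈ s,
      t ∈ Set.Ioo (0 : ℝ) 1 ∧ ∀ i, v i = t * (inner ℝ (b i.succ) (y : EuclideanSpace ℝ (Fin (n + 1)))
        / inner ℝ (x : EuclideanSpace ℝ (Fin (n + 1))) (y : EuclideanSpace ℝ (Fin (n + 1)))) := by
    intro t v h
    obtain ⟨r, hr, _, ⟨y, hy, rfl⟩, hry⟩ := h
    have hΦy : Φ (r • (y : EuclideanSpace ℝ (Fin (n + 1)))) = (t, v) := by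
      have : r • (y : EuclideanSpace ℝ (Fin (n + 1))) = Φ.symm (t, v) := hry
      rw [this, MeasurableEquiv.apply_symm_apply]
    have ht : t = r * inner ℝ (x : EuclideanSpace ℝ (Fin (n + 1))) (y : EuclideanSpace ℝ (Fin (n + 1))) := by
      rw [← real_inner_smul_right, ← hΦ1, hΦy]
    have hv : ∀ i, v i = r * inner ℝ (b i.succ) (y : EuclideanSpace ℝ (Fin (n + 1))) := by
      intro i
      rw [← real_inner_smul_right, ← hΦ2, hΦy]
    have hy1 : ‖(y : EuclideanSpace ℝ (Fin (n + 1)))‖ = 1 := by simp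
    have hxy : 0 < inner ℝ (x : EuclideanSpace ℝ (Fin (n + 1))) (y : EuclideanSpace ℝ (Fin (n + 1))) := by
      have h1 := (hdist y hy x hxs).trans hdle
      rw [dist_eq_norm] at h1
      have h2 := norm_sub_sq_real (y : EuclideanSpace ℝ (Fin (n + 1))) x
      rw [real_inner_comm, hy1, hx] at h2
      nlinarith [norm_nonneg ((y : EuclideanSpace ℝ (Fin (n + 1))) - x)]
    have hxy1 : inner ℝ (x : EuclideanSpace ℝ (Fin (n + 1))) (y : EuclideanSpace ℝ (Fin (n + 1))) ≤ 1 := by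
      have := real_inner_le_norm (x : EuclideanSpace ℝ (Fin (n + 1))) y
      rwa [hx, hy1, one_mul] at this
    refine ⟨y, hy, ⟨ht ▸ mul_pos hr.1 hxy, ?_⟩, fun i => ?_⟩
    · rw [ht]; nlinarith [hr.1, hr.2]
    · rw [hv, ht]; field_simp
  have hslice : ∀ t, volume (Prod.mk t ⁻¹' (Φ.symm ⁻¹' C)) ≤
      (Set.Ioo (0 : ℝ) 1).indicator (fun t => ENNReal.ofReal (t ^ n) * ENNReal.ofReal ((L * d) ^ n)) t := by
    intro t
    by_cases ht : t ∈ Set.Ioo (0 : ℝ) 1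
    · rw [Set.indicator_of_mem ht, ← ENNReal.ofReal_mul (pow_nonneg ht.1.le _), ← mul_pow,
        ENNReal.ofReal_pow (mul_nonneg ht.1.le (by positivity))]
      refine (Real.volume_pi_le_diam_pow _).trans ?_
      rw [Fintype.card_fin]
      gcongr
      refine ediam_le fun v hv w hw => ?_
      obtain ⟨y, hy, -, hvy⟩ := hmem t v hv
      obtain ⟨z, hz, -, hwz⟩ := hmem t w hw
      rw [edist_dist]
      refine ENNReal.ofReal_le_ofReal ((dist_pi_le_iff (mul_nonneg ht.1.le (by positivity))).2 fun i => ?_)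
      rw [Real.dist_eq, hvy, hwz, ← mul_sub, abs_mul, abs_of_pos ht.1]
      refine mul_le_mul_of_nonneg_left ?_ ht.1.le
      exact abs_inner_div_inner_sub_le hε0.le hε hx (b.norm_eq_one _) (hbs i)
        ((hdist y hy x hxs).trans hdle) ((hdist z hz x hxs).trans hdle) (hdist y hy z hz)
    · have : Prod.mk t ⁻¹' (Φ.symm ⁻¹' C) = ∅ := by
        ext v
        simp only [Set.mem_preimage, Set.mem_empty_iff_false, iff_false]
        intro h
        obtain ⟨y, -, h1, -⟩ := hmem t v h
        exact ht h1
      rw [this]; simp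
  have hint : ∫⁻ t in Set.Ioo (0 : ℝ) 1, ENNReal.ofReal (t ^ n) = ENNReal.ofReal (1 / (n + 1)) := by
    rw [restrict_Ioo_eq_restrict_Ioc, ← ofReal_integral_eq_lintegral_ofReal,
      ← intervalIntegral.integral_of_le zero_le_one]
    · simp
    · exact (intervalIntegral.intervalIntegrable_pow n).1
    · filter_upwards [ae_restrict_mem measurableSet_Ioc] with t ht
      exact pow_nonneg ht.1.le _
  rw [Measure.toSphere_apply' _ hcl.measurableSet, ← hC, hvol]
  refine (mul_le_mul_right (lintegral_mono hslice) _).trans ?_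
  rw [lintegral_indicator measurableSet_Ioo, lintegral_mul_const _ (by fun_prop), hint,
    finrank_euclideanSpace_fin, ← mul_assoc, ← ENNReal.ofReal_natCast, ← ENNReal.ofReal_mul (by positivity)]
  have h1 : ((n + 1 : ℕ) : ℝ) * (1 / (n + 1)) = 1 := by
    push_cast; field_simp
  rw [h1, ENNReal.ofReal_one, one_mul, ENNReal.ofReal_pow (by positivity), ENNReal.ofReal_mul hL0, hd,
    ENNReal.ofReal_toReal hfin]

/-- The surface measure on the unit sphere is dominated by the Hausdorff measure `μH[n]`, which is
normalized by powers of diameters and is therefore larger in general. -/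
theorem toSphere_le_hausdorffMeasure (n : ℕ) :
    (volume : Measure (EuclideanSpace ℝ (Fin (n + 1)))).toSphere ≤ μH[(n : ℝ)] := by
  have key : ∀ ε ∈ Set.Ioo (0 : ℝ) 1, ∀ A : Set (sphere (0 : EuclideanSpace ℝ (Fin (n + 1))) 1),
      (volume : Measure (EuclideanSpace ℝ (Fin (n + 1)))).toSphere A ≤
        ENNReal.ofReal ((1 / (1 - ε) + ε / (1 - ε) ^ 2) ^ n) * μH[(n : ℝ)] A := by
    intro ε hε A
    have m0 : 0 < 1 - ε := by linarith [hε.2]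
    have hL0 : 0 < 1 / (1 - ε) + ε / (1 - ε) ^ 2 := by have := hε.1; positivity
    set c : ℝ≥0∞ := ENNReal.ofReal ((1 / (1 - ε) + ε / (1 - ε) ^ 2) ^ n) with hc
    have hc0 : c ≠ 0 := by simp only [hc, ne_eq, ENNReal.ofReal_eq_zero, not_le]; positivity
    have hct : c ≠ ⊤ := ENNReal.ofReal_ne_top
    have := Measure.le_hausdorffMeasure (n : ℝ)
      (c⁻¹ • (volume : Measure (EuclideanSpace ℝ (Fin (n + 1)))).toSphere)
      (ENNReal.ofReal ε) (by simpa using hε.1) (fun s hs => by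
        rw [Measure.smul_apply, smul_eq_mul, ENNReal.inv_mul_le_iff hc0 hct, ENNReal.rpow_natCast,
          hc, ENNReal.ofReal_pow hL0.le, ← mul_pow]
        exact toSphere_le_of_ediam_le hε.1 hε.2 s hs) A
    rwa [Measure.smul_apply, smul_eq_mul, ENNReal.inv_mul_le_iff hc0 hct] at this
  intro A
  have hlim : Filter.Tendsto (fun ε : ℝ => ENNReal.ofReal ((1 / (1 - ε) + ε / (1 - ε) ^ 2) ^ n) *
      μH[(n : ℝ)] A) (nhdsWithin 0 (Set.Ioi 0)) (nhds (1 * μH[(n : ℝ)] A)) := by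
    refine ENNReal.Tendsto.mul_const ?_ (Or.inl one_ne_zero)
    rw [← ENNReal.ofReal_one]
    refine ENNReal.tendsto_ofReal ?_
    have : ContinuousAt (fun ε : ℝ => (1 / (1 - ε) + ε / (1 - ε) ^ 2) ^ n) 0 := by
      refine ContinuousAt.pow (ContinuousAt.add ?_ ?_) n
      · exact ContinuousAt.div (by fun_prop) (by fun_prop) (by norm_num)
      · exact ContinuousAt.div (by fun_prop) (by fun_prop) (by norm_num)
    have h2 := this.tendsto
    simp only [sub_zero, div_one, one_pow, add_zero] at h2
    exact h2.mono_left nhdsWithin_le_nhds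
  rw [one_mul] at hlim
  refine ge_of_tendsto hlim ?_
  filter_upwards [Ioo_mem_nhdsGT (zero_lt_one' ℝ)] with ε hε
  exact key ε hε A

theorem hausdorffMeasure_sphere_lt_top (n : ℕ) {R : ℝ} (hR : 0 < R) :
    μH[(n : ℝ)] (sphere (0 : EuclideanSpace ℝ (Fin (n + 1))) R) < ⊤ := by
  let w : Fin (n + 1) → ℝ → (Fin n → ℝ) → EuclideanSpace ℝ (Fin (n + 1)) :=
    fun i s v => WithLp.toLp 2 (i.insertNth (α := fun _ => ℝ) s v)
  let f : Fin (n + 1) → ℝ → (Fin n → ℝ) → EuclideanSpace ℝ (Fin (n + 1)) :=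
    fun i s v => (R / ‖w i s v‖) • w i s v
  have hw0 : ∀ i s v, s ≠ 0 → w i s v ≠ 0 := by
    intro i s v hs h
    have : (w i s v) i = 0 := by rw [h]; rfl
    exact hs (by simpa [w] using this)
  have hwc : ∀ i s, ContDiff ℝ 1 (w i s) := by
    intro i s
    rw [contDiff_piLp]
    intro j
    rcases Fin.eq_self_or_eq_succAbove i j with rfl | ⟨j, rfl⟩
    · simp only [w, Fin.insertNth_apply_same]; fun_prop
    · simp only [w, Fin.insertNth_apply_succAbove]; fun_prop
  have hfc : ∀ i s, s ≠ 0 → ContDiff ℝ 1 (f i s) := by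
    intro i s hs
    refine ContDiff.smul (ContDiff.div contDiff_const ((hwc i s).norm ℝ fun v => hw0 i s v hs) ?_)
      (hwc i s)
    exact fun v => norm_ne_zero_iff.2 (hw0 i s v hs)
  have hfin : ∀ i s, s ≠ 0 → μH[(n : ℝ)] (f i s '' closedBall 0 1) < ⊤ := by
    intro i s hs
    obtain ⟨K, hK⟩ := (hfc i s hs).contDiffOn.exists_lipschitzOnWith one_ne_zero
      (convex_closedBall (0 : Fin n → ℝ) 1) (isCompact_closedBall _ _)
    refine (hK.hausdorffMeasure_image_le (Nat.cast_nonneg n)).trans_lt ?_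
    have hv := hausdorffMeasure_pi_real (ι := Fin n)
    rw [Fintype.card_fin] at hv
    rw [hv, ENNReal.rpow_natCast]
    exact ENNReal.mul_lt_top (ENNReal.pow_lt_top ENNReal.coe_lt_top) measure_closedBall_lt_top
  have hcover : sphere (0 : EuclideanSpace ℝ (Fin (n + 1))) R ⊆
      ⋃ i, (f i 1 '' closedBall 0 1 ∪ f i (-1) '' closedBall 0 1) := by
    intro x hx
    have hxR : ‖x‖ = R := by simpa using hx
    obtain ⟨i, hi⟩ := Finite.exists_max (fun i => |x i|)
    have hxi : 0 < |x i| := by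
      rw [abs_pos]
      intro h0
      have : x = 0 := by
        ext j
        have := hi j
        rw [h0, abs_zero] at this
        simpa using this
      rw [this, norm_zero] at hxR
      exact hR.ne hxR
    have hxi' : x i ≠ 0 := abs_pos.1 hxi
    have key : ∀ s, s * |x i| = x i → x ∈ f i s '' closedBall 0 1 := by
      intro s hs
      have hwx : w i s (fun j => |x i|⁻¹ * x (i.succAbove j)) = |x i|⁻¹ • x := by
        ext j
        rcases Fin.eq_self_or_eq_succAbove i j with rfl | ⟨j, rfl⟩
        · simp only [w, Fin.insertNth_apply_same, PiLp.smul_apply, smul_eq_mul]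
          field_simp; exact hs
        · simp only [w, Fin.insertNth_apply_succAbove, PiLp.smul_apply, smul_eq_mul]
      refine ⟨fun j => |x i|⁻¹ * x (i.succAbove j), ?_, ?_⟩
      · rw [mem_closedBall_zero_iff, pi_norm_le_iff_of_nonneg zero_le_one]
        intro j
        rw [norm_mul, norm_inv, Real.norm_eq_abs, Real.norm_eq_abs, abs_abs, inv_mul_le_one₀ hxi]
        exact hi _
      · simp only [f, hwx, norm_smul, norm_inv, Real.norm_eq_abs, abs_abs, hxR, smul_smul]
        have : R / (|x i|⁻¹ * R) * |x i|⁻¹ = 1 := by field_simp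
        rw [this, one_smul]
    rw [Set.mem_iUnion]
    refine ⟨i, ?_⟩
    rcases le_total 0 (x i) with h | h
    · exact Or.inl (key 1 (by rw [abs_of_nonneg h, one_mul]))
    · exact Or.inr (key (-1) (by rw [abs_of_nonpos h]; ring))
  refine (measure_mono hcover).trans_lt ?_
  refine (measure_iUnion_le _).trans_lt ?_
  rw [tsum_fintype, ENNReal.sum_lt_top]
  intro i _
  exact (measure_union_le _ _).trans_lt
    (ENNReal.add_lt_top.2 ⟨hfin i 1 one_ne_zero, hfin i (-1) (by norm_num)⟩)

theorem map_smul_toSphere_le_hausdorffMeasure (n : ℕ) {R : ℝ} (hR : 0 < R) :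
    ENNReal.ofReal (R ^ n) • (volume : Measure (EuclideanSpace ℝ (Fin (n + 1)))).toSphere.map
        (fun ω : sphere (0 : EuclideanSpace ℝ (Fin (n + 1))) 1 =>
          R • (ω : EuclideanSpace ℝ (Fin (n + 1)))) ≤
      (μH[(n : ℝ)]).restrict (sphere (0 : EuclideanSpace ℝ (Fin (n + 1))) R) := by
  refine Measure.le_iff.2 fun A hA => ?_
  set T : Set (sphere (0 : EuclideanSpace ℝ (Fin (n + 1))) 1) :=
    (fun ω => R • (ω : EuclideanSpace ℝ (Fin (n + 1)))) ⁻¹' A with hT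
  rw [Measure.smul_apply, Measure.map_apply (by fun_prop) hA, Measure.restrict_apply hA, ← hT,
    smul_eq_mul]
  have h1 := toSphere_le_hausdorffMeasure n T
  rw [← isometry_subtype_coe.hausdorffMeasure_image (Or.inl (Nat.cast_nonneg n))] at h1
  have h2 : R • ((↑) '' T : Set (EuclideanSpace ℝ (Fin (n + 1)))) ⊆ A ∩ sphere 0 R := by
    rintro _ ⟨_, ⟨ω, hω, rfl⟩, rfl⟩
    exact ⟨hω, by simp [norm_smul, abs_of_pos hR]⟩
  refine le_trans ?_ (measure_mono h2)
  rw [Measure.hausdorffMeasure_smul₀ (Nat.cast_nonneg n) hR.ne', ENNReal.smul_def, smul_eq_mul]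
  have h3 : ((‖R‖₊ ^ (n : ℝ) : NNReal) : ℝ≥0∞) = ENNReal.ofReal (R ^ n) := by
    rw [NNReal.rpow_natCast, ENNReal.coe_pow, ENNReal.ofReal_pow hR.le, ← enorm_eq_nnnorm,
      Real.enorm_of_nonneg hR.le]
  rw [h3]
  gcongr

theorem integral_toSphere_le_integral_hausdorffMeasure (n : ℕ) {R : ℝ} (hR : 0 < R)
    {f : EuclideanSpace ℝ (Fin (n + 1)) → ℝ} (hf : ContinuousOn f (sphere 0 R))
    (hf0 : ∀ x ∈ sphere (0 : EuclideanSpace ℝ (Fin (n + 1))) R, 0 ≤ f x) :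
    R ^ n * ∫ ω, f (R • (ω : EuclideanSpace ℝ (Fin (n + 1))))
        ∂(volume : Measure (EuclideanSpace ℝ (Fin (n + 1)))).toSphere ≤
      ∫ x in sphere (0 : EuclideanSpace ℝ (Fin (n + 1))) R, f x ∂(μH[(n : ℝ)]) := by
  have hint : IntegrableOn f (sphere 0 R) (μH[(n : ℝ)]) :=
    hf.integrableOn_of_subset_isCompact (isCompact_sphere _ _) isClosed_sphere.measurableSet
      subset_rfl (hausdorffMeasure_sphere_lt_top n hR).ne
  have hle := map_smul_toSphere_le_hausdorffMeasure n hR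
  have h := integral_mono_measure hle (f := f)
    (by filter_upwards [ae_restrict_mem isClosed_sphere.measurableSet] with x hx using hf0 x hx) hint
  refine le_trans (le_of_eq ?_) h
  have hc : ENNReal.ofReal (R ^ n) ≠ 0 := by
    simp only [ne_eq, ENNReal.ofReal_eq_zero, not_le]; positivity
  rw [integral_smul_measure, ENNReal.toReal_ofReal (by positivity), smul_eq_mul, integral_map]
  · fun_prop
  · have := (Integrable.mono_measure hint hle).aestronglyMeasurable
    exact this.mono_ac (Measure.AbsolutelyContinuous.smul_right Measure.AbsolutelyContinuous.rfl hc)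

/-- Integration over a ball in polar coordinates. -/
theorem setIntegral_ball_eq_integral_toSphere (n : ℕ) {R : ℝ}
    {F : EuclideanSpace ℝ (Fin (n + 1)) → ℝ} (hF : IntegrableOn F (ball 0 R)) :
    ∫ x in ball (0 : EuclideanSpace ℝ (Fin (n + 1))) R, F x =
      ∫ ω, (∫ r in Set.Ioo 0 R, r ^ n * F (r • (ω : EuclideanSpace ℝ (Fin (n + 1)))))
        ∂(volume : Measure (EuclideanSpace ℝ (Fin (n + 1)))).toSphere := by
  set G := (ball (0 : EuclideanSpace ℝ (Fin (n + 1))) R).indicator F with hG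
  have hGi : Integrable G := by
    rwa [hG, integrable_indicator_iff measurableSet_ball]
  have hmp := (volume : Measure (EuclideanSpace ℝ (Fin (n + 1)))).measurePreserving_homeomorphUnitSphereProd
  rw [finrank_euclideanSpace_fin, Nat.add_sub_cancel] at hmp
  have hemb := (homeomorphUnitSphereProd (EuclideanSpace ℝ (Fin (n + 1)))).measurableEmbedding
  set g : sphere (0 : EuclideanSpace ℝ (Fin (n + 1))) 1 × Set.Ioi (0 : ℝ) → ℝ :=
    fun z => G (z.2.1 • z.1.1) with hg
  have hcomp : g ∘ homeomorphUnitSphereProd (EuclideanSpace ℝ (Fin (n + 1))) = fun x => G x.1 := by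
    funext x
    have h0 : ‖x.1‖ ≠ 0 := norm_ne_zero_iff.2 x.2
    simp only [hg, Function.comp, homeomorphUnitSphereProd_apply_fst_coe,
      homeomorphUnitSphereProd_apply_snd_coe, smul_smul, mul_inv_cancel₀ h0, one_smul]
  have hgi : Integrable g
      ((volume : Measure (EuclideanSpace ℝ (Fin (n + 1)))).toSphere.prod (.volumeIoiPow n)) := by
    rw [← hmp.integrable_comp_emb hemb, hcomp]
    exact (integrableOn_iff_comap_subtypeVal (measurableSet_singleton _).compl).1 hGi.integrableOn
  calc
    ∫ x in ball (0 : EuclideanSpace ℝ (Fin (n + 1))) R, F x = ∫ x, G x := by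
      rw [hG, integral_indicator measurableSet_ball]
    _ = ∫ x : ({0}ᶜ : Set (EuclideanSpace ℝ (Fin (n + 1)))), G x ∂(volume.comap Subtype.val) := by
      rw [integral_subtype_comap (measurableSet_singleton _).compl fun x ↦ G x,
        restrict_compl_singleton]
    _ = ∫ z, g z ∂((volume : Measure (EuclideanSpace ℝ (Fin (n + 1)))).toSphere.prod
          (.volumeIoiPow n)) := by
      rw [← hmp.integral_comp hemb]
      exact congrArg (fun h => ∫ x, h x ∂(volume.comap Subtype.val)) hcomp.symm
    _ = ∫ ω, (∫ r, g (ω, r) ∂(.volumeIoiPow n))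
        ∂(volume : Measure (EuclideanSpace ℝ (Fin (n + 1)))).toSphere := integral_prod _ hgi
    _ = _ := by
      congr 1
      funext ω
      simp only [Measure.volumeIoiPow, ENNReal.ofReal, hg]
      rw [integral_withDensity_eq_integral_smul,
        integral_subtype_comap measurableSet_Ioi
          fun a ↦ Real.toNNReal (a ^ n) • G (a • (ω : EuclideanSpace ℝ (Fin (n + 1)))),
        ← integral_indicator measurableSet_Ioi, ← integral_indicator measurableSet_Ioo]
      · congr 1
        funext r
        by_cases hr : 0 < r
        · by_cases hrR : r < R
          · simp [hr, hrR, hG, Set.indicator, norm_smul, abs_of_pos hr, NNReal.smul_def, hr.le]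
          · simp [hr, hrR, hG, Set.indicator, norm_smul, abs_of_pos hr]
        · simp [hr]
      · exact (measurable_subtype_coe.pow_const _).real_toNNReal

/-- Strict form of Young's inequality. -/
theorem young_rpow_lt {p u v : ℝ} (hp : 1 < p) (hu : 0 ≤ u) (hv : 0 ≤ v) (huv : u ≠ v) :
    p * u ^ (p - 1) * v < (p - 1) * u ^ p + v ^ p := by
  rcases hu.eq_or_lt with rfl | hu
  · have : 0 < v ^ p := rpow_pos_of_pos (lt_of_le_of_ne hv huv) _
    rw [zero_rpow (by linarith), zero_rpow (by linarith)]
    simpa using this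
  · have hs : v / u - 1 ≠ 0 := by
      rw [sub_ne_zero, ne_eq, div_eq_one_iff_eq hu.ne']
      exact huv.symm
    have h := one_add_mul_self_lt_rpow_one_add (s := v / u - 1)
      (by have : 0 ≤ v / u := by positivity
          linarith) hs hp
    rw [add_sub_cancel, div_rpow hv hu.le, lt_div_iff₀ (rpow_pos_of_pos hu p)] at h
    have hup : u ^ p = u ^ (p - 1) * u := by
      rw [← rpow_add_one hu.ne']; ring_nf
    have : (1 + p * (v / u - 1)) * u ^ p = p * u ^ (p - 1) * v - (p - 1) * u ^ p := by
      rw [hup]; field_simp; ring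
    linarith

theorem young_rpow_le {p u v : ℝ} (hp : 1 ≤ p) (hu : 0 ≤ u) (hv : 0 ≤ v) :
    p * u ^ (p - 1) * v ≤ (p - 1) * u ^ p + v ^ p := by
  rcases hp.eq_or_lt with rfl | hp
  · simp
  rcases eq_or_ne u v with rfl | huv
  · rcases hu.eq_or_lt with rfl | hu
    · rw [zero_rpow (by linarith : p ≠ 0)]; simp
    · have hup : u ^ p = u ^ (p - 1) * u := by
        rw [← rpow_add_one hu.ne']; ring_nf
      rw [hup]; linarith
  · exact (young_rpow_lt hp hu hv huv).le

theorem integral_deriv_rpow_mul_rpow {R a p : ℝ} (hR : 0 < R) (ha : 0 < a) (hp : 1 ≤ p)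
    {f f' : ℝ → ℝ} (hf : ∀ r ∈ Set.Icc 0 R, HasDerivAt f (f' r) r)
    (hf' : ContinuousOn f' (Set.Icc 0 R)) :
    ∫ r in Set.Ioo 0 R, r ^ (a - 1) * (a * f r ^ p + p * f r ^ (p - 1) * (r * f' r)) =
      R ^ a * f R ^ p := by
  have hfc : ContinuousOn f (Set.Icc 0 R) := fun r hr => (hf r hr).continuousAt.continuousWithinAt
  rw [← integral_Ioc_eq_integral_Ioo, ← intervalIntegral.integral_of_le hR.le,
    intervalIntegral.integral_eq_sub_of_hasDerivAt_of_le hR.le (f := fun r => r ^ a * f r ^ p)]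
  · rw [zero_rpow ha.ne']; ring
  · exact (continuousOn_id.rpow_const fun _ _ => Or.inr ha.le).mul
      (hfc.rpow_const fun _ _ => Or.inr (by linarith))
  · intro r hr
    have h1 : HasDerivAt (fun r : ℝ => r ^ a) (a * r ^ (a - 1)) r :=
      Real.hasDerivAt_rpow_const (Or.inl hr.1.ne')
    have h2 := (hf r ⟨hr.1.le, hr.2.le⟩).rpow_const (p := p) (Or.inr hp)
    refine (h1.mul h2).congr_deriv ?_
    have : r ^ a = r ^ (a - 1) * r := by rw [← rpow_add_one hr.1.ne']; ring_nf
    rw [this]; ring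
  · refine (intervalIntegral.intervalIntegrable_rpow' (by linarith)).mul_continuousOn ?_
    rw [Set.uIcc_of_le hR.le]
    refine ContinuousOn.add ?_ ?_
    · exact continuousOn_const.mul (hfc.rpow_const fun _ _ => Or.inr (by linarith))
    · exact (continuousOn_const.mul (hfc.rpow_const fun _ _ => Or.inr (by linarith))).mul
        (continuousOn_id.mul hf')

theorem integrableOn_norm_rpow_neg_mul {n : ℕ} {γ R : ℝ} (hγ : γ < n + 1)
    {g : EuclideanSpace ℝ (Fin (n + 1)) → ℝ} (hg : ContinuousOn g (closedBall 0 R)) :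
    IntegrableOn (fun x => ‖x‖ ^ (-γ) * g x) (ball 0 R) := by
  refine IntegrableOn.mul_continuousOn_of_subset ?_ hg measurableSet_ball
    (isCompact_closedBall _ _) ball_subset_closedBall
  rw [integrableOn_fun_norm_addHaar volume (f := fun r => r ^ (-γ)), finrank_euclideanSpace_fin,
    Nat.add_sub_cancel]
  have h : IntegrableOn (fun r : ℝ => r ^ (n - γ)) (Set.Ioo 0 R) := by
    rcases le_total R 0 with hR | hR
    · simp [Set.Ioo_eq_empty_of_le hR]
    · exact (intervalIntegral.intervalIntegrable_rpow' (by linarith) (a := 0) (b := R)).1.mono_set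
        Set.Ioo_subset_Ioc_self
  refine h.congr_fun (fun r hr => ?_) measurableSet_Ioo
  simp only [smul_eq_mul]
  rw [sub_eq_add_neg, rpow_add hr.1, rpow_natCast]

section C1

variable {E : Type*} [NormedAddCommGroup E] [InnerProductSpace ℝ E] [CompleteSpace E]
  {ψ : E → ℝ} {U : Set E}

theorem hasDerivAt_comp_smul_of_contDiffOn (hU : IsOpen U) (hψ : ContDiffOn ℝ 1 ψ U) {x : E}
    {r : ℝ} (hr : r • x ∈ U) :
    HasDerivAt (fun t : ℝ => ψ (t • x)) (inner ℝ (gradient ψ (r • x)) x) r := by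
  have h1 : HasFDerivAt ψ (fderiv ℝ ψ (r • x)) (r • x) :=
    ((hψ.differentiableOn one_ne_zero).differentiableAt (hU.mem_nhds hr)).hasFDerivAt
  have h2 : HasDerivAt (fun t : ℝ => t • x) x r := by
    simpa using (hasDerivAt_id r).smul_const x
  refine (h1.comp_hasDerivAt r h2).congr_deriv ?_
  rw [gradient, InnerProductSpace.toDual_symm_apply]

theorem continuousOn_gradient_of_contDiffOn (hU : IsOpen U) (hψ : ContDiffOn ℝ 1 ψ U) :
    ContinuousOn (gradient ψ) U :=
  (InnerProductSpace.toDual ℝ E).symm.continuous.comp_continuousOn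
    (hψ.continuousOn_fderiv_of_isOpen hU le_rfl)

/-- A `C¹` function satisfying the Euler equation `⟪∇ψ(x), x⟫ = -c ψ(x)` of negative degree
in a ball around the origin vanishes on the closed ball. -/
theorem eq_zero_of_inner_gradient_eq_neg {R c : ℝ} (hR : 0 < R) (hc : 0 < c) (hU : IsOpen U)
    (hBU : closedBall 0 R ⊆ U) (hψ : ContDiffOn ℝ 1 ψ U)
    (h : ∀ x ∈ ball (0 : E) R, inner ℝ (gradient ψ x) x = -(c * ψ x))
    {x : E} (hx : x ∈ closedBall 0 R) : ψ x = 0 := by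
  have hxR : ‖x‖ ≤ R := by simpa using hx
  have hmem : ∀ t ∈ Set.Icc (0 : ℝ) 1, t • x ∈ closedBall (0 : E) R := by
    intro t ht
    rw [mem_closedBall_zero_iff, norm_smul, Real.norm_eq_abs, abs_of_nonneg ht.1]
    nlinarith [ht.2, norm_nonneg x]
  have hderiv : ∀ t ∈ Set.Icc (0 : ℝ) 1, HasDerivAt (fun t : ℝ => ψ (t • x))
      (inner ℝ (gradient ψ (t • x)) x) t := fun t ht =>
    hasDerivAt_comp_smul_of_contDiffOn hU hψ (hBU (hmem t ht))
  have key := intervalIntegral.integral_eq_sub_of_hasDerivAt_of_le zero_le_one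
    (f := fun t : ℝ => t ^ c * ψ (t • x)) (f' := fun _ => 0) ?_ ?_ (by simp)
  · simpa [hc.ne'] using key.symm
  · exact (continuousOn_id.rpow_const fun _ _ => Or.inr hc.le).mul
      fun t ht => (hderiv t ht).continuousAt.continuousWithinAt
  · intro t ht
    have h1 : HasDerivAt (fun r : ℝ => r ^ c) (c * t ^ (c - 1)) t :=
      Real.hasDerivAt_rpow_const (Or.inl ht.1.ne')
    refine (h1.mul (hderiv t ⟨ht.1.le, ht.2.le⟩)).congr_deriv ?_
    have hb : t • x ∈ ball (0 : E) R := by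
      rw [mem_ball_zero_iff, norm_smul, Real.norm_eq_abs, abs_of_pos ht.1]
      nlinarith [ht.1, ht.2]
    have h3 := h _ hb
    rw [real_inner_smul_right] at h3
    have : t ^ c = t ^ (c - 1) * t := by rw [← rpow_add_one ht.1.ne']; ring_nf
    rw [this]; linear_combination t ^ (c - 1) * h3

end C1

/-- Divergence theorem on a ball for the radial vector field `ψ(x)^p ‖x‖^(-γ) x`. -/
theorem integral_ball_radial_divergence {n : ℕ} {p γ R : ℝ} (hp : 1 ≤ p) (hγ : γ < n + 1)
    (hR : 0 < R) {ψ : EuclideanSpace ℝ (Fin (n + 1)) → ℝ}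
    {U : Set (EuclideanSpace ℝ (Fin (n + 1)))} (hU : IsOpen U) (hBU : closedBall 0 R ⊆ U)
    (hψ : ContDiffOn ℝ 1 ψ U) :
    ∫ x in ball (0 : EuclideanSpace ℝ (Fin (n + 1))) R, ‖x‖ ^ (-γ) *
        ((n + 1 - γ) * ψ x ^ p + p * ψ x ^ (p - 1) * inner ℝ (gradient ψ x) x) =
      R ^ (n + 1 - γ) * ∫ ω, ψ (R • (ω : EuclideanSpace ℝ (Fin (n + 1)))) ^ p
        ∂(volume : Measure (EuclideanSpace ℝ (Fin (n + 1)))).toSphere := by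
  have hψc : ContinuousOn ψ (closedBall 0 R) := hψ.continuousOn.mono hBU
  have hgc : ContinuousOn (gradient ψ) (closedBall 0 R) :=
    (continuousOn_gradient_of_contDiffOn hU hψ).mono hBU
  rw [setIntegral_ball_eq_integral_toSphere, ← integral_const_mul]
  · congr 1
    funext ω
    have hmem : ∀ t ∈ Set.Icc (0 : ℝ) R,
        t • (ω : EuclideanSpace ℝ (Fin (n + 1))) ∈ closedBall (0 : EuclideanSpace ℝ (Fin (n + 1))) R := by
      intro t ht
      simpa [norm_smul, abs_of_nonneg ht.1] using ht.2
    rw [← integral_deriv_rpow_mul_rpow hR (sub_pos.2 hγ) hp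
      (f := fun t => ψ (t • (ω : EuclideanSpace ℝ (Fin (n + 1)))))
      (fun t ht => hasDerivAt_comp_smul_of_contDiffOn hU hψ (hBU (hmem t ht)))]
    · refine setIntegral_congr_fun measurableSet_Ioo fun r hr => ?_
      have h1 : ‖r • (ω : EuclideanSpace ℝ (Fin (n + 1)))‖ = r := by
        simp [norm_smul, abs_of_pos hr.1]
      have h2 : r ^ ((n : ℝ) + 1 - γ - 1) = r ^ n * r ^ (-γ) := by
        rw [← rpow_natCast r n, ← rpow_add hr.1]; ring_nf
      simp only [h1, h2, real_inner_smul_right]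
      ring
    · refine ContinuousOn.inner (𝕜 := ℝ) (hgc.comp (by fun_prop) hmem) continuousOn_const
  · refine integrableOn_norm_rpow_neg_mul hγ ?_
    refine ContinuousOn.add ?_ ?_
    · exact continuousOn_const.mul (hψc.rpow_const fun _ _ => Or.inr (by linarith))
    · exact (continuousOn_const.mul (hψc.rpow_const fun _ _ => Or.inr (by linarith))).mul
        (hgc.inner (𝕜 := ℝ) continuousOn_id)

/-- Pointwise nonnegativity behind the Hardy inequality: Young's inequality combined with
`|w| ≤ v`. -/
theorem hardy_pointwise_nonneg {p a u v w : ℝ} (hp : 1 ≤ p) (ha : 0 < a) (hu : 0 ≤ u) (hv : 0 ≤ v)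
    (hw : |w| ≤ v) :
    0 ≤ v ^ p + (a / p) ^ (p - 1) * (a * u ^ p + p * u ^ (p - 1) * w) - (a / p) ^ p * u ^ p ∧
    (1 < p →
      v ^ p + (a / p) ^ (p - 1) * (a * u ^ p + p * u ^ (p - 1) * w) - (a / p) ^ p * u ^ p = 0 →
      w = -(a / p * u)) := by
  have hp0 : 0 < p := by linarith
  set c := a / p with hc
  have hc0 : 0 < c := by positivity
  have hcu : 0 ≤ c * u := by positivity
  have hac : a = p * c := by rw [hc]; field_simp
  have hcp : c ^ p = c ^ (p - 1) * c := by rw [← rpow_add_one hc0.ne']; ring_nf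
  have hH : v ^ p + c ^ (p - 1) * (a * u ^ p + p * u ^ (p - 1) * w) - c ^ p * u ^ p =
      v ^ p + (p - 1) * (c * u) ^ p - p * (c * u) ^ (p - 1) * v
        + p * (c * u) ^ (p - 1) * (w + v) := by
    rw [mul_rpow hc0.le hu, mul_rpow hc0.le hu, hcp, hac]; ring
  have hY := young_rpow_le hp hcu hv
  have hpw : 0 ≤ p * (c * u) ^ (p - 1) * (w + v) :=
    mul_nonneg (by positivity) (by linarith [(abs_le.1 hw).1])
  rw [hH]
  refine ⟨by linarith, fun hp1 h0 => ?_⟩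
  have huv : c * u = v := by
    by_contra hne
    have := young_rpow_lt hp1 hcu hv hne
    linarith
  have hz : p * (c * u) ^ (p - 1) * (w + v) = 0 := by linarith
  rcases hcu.eq_or_lt with h | h
  · have hv0 : v = 0 := by rw [← huv, ← h]
    rw [hv0] at hw
    rw [← h, neg_zero]
    exact abs_nonpos_iff.1 hw
  · have : w + v = 0 := by
      rcases mul_eq_zero.1 hz with h1 | h1
      · exact absurd h1 (by positivity)
      · exact h1
    linarith

end

/-- Hardy inequality with boundary term on the closed ball `B̄(0,R) ⊆ ℝᵏ`
(flat case of Theorem `teo-hardy` of the paper, where `Φ = 0` and `⟨∇̄r, ν⟩ = 1` on the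
boundary sphere), together with its equality case for `p > 1`. -/
theorem hardy_ball (k : ℕ) (hk : 1 ≤ k) (p γ : ℝ) (hp : 1 ≤ p) (hγ : γ < (k : ℝ))
    (R : ℝ) (hR : 0 < R) (ψ : EuclideanSpace ℝ (Fin k) → ℝ)
    (U : Set (EuclideanSpace ℝ (Fin k))) (hU : IsOpen U)
    (hBU : closedBall (0 : EuclideanSpace ℝ (Fin k)) R ⊆ U)
    (hψ : ContDiffOn ℝ 1 ψ U) (hpos : ∀ x ∈ U, 0 ≤ ψ x) :
    (((k : ℝ) - γ) / p) ^ p *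
        ∫ x in ball (0 : EuclideanSpace ℝ (Fin k)) R, ψ x ^ p * ‖x‖ ^ (-γ)
      ≤ (∫ x in ball (0 : EuclideanSpace ℝ (Fin k)) R, ‖gradient ψ x‖ ^ p * ‖x‖ ^ (p - γ))
        + (((k : ℝ) - γ) / p) ^ (p - 1) * R ^ (1 - γ) *
            ∫ x in sphere (0 : EuclideanSpace ℝ (Fin k)) R, ψ x ^ p ∂(μH[(k : ℝ) - 1])
    ∧ (1 < p →
        ((((k : ℝ) - γ) / p) ^ p *
            (∫ x in ball (0 : EuclideanSpace ℝ (Fin k)) R, ψ x ^ p * ‖x‖ ^ (-γ))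
          = (∫ x in ball (0 : EuclideanSpace ℝ (Fin k)) R, ‖gradient ψ x‖ ^ p * ‖x‖ ^ (p - γ))
            + (((k : ℝ) - γ) / p) ^ (p - 1) * R ^ (1 - γ) *
                ∫ x in sphere (0 : EuclideanSpace ℝ (Fin k)) R, ψ x ^ p ∂(μH[(k : ℝ) - 1])
          ↔ ∀ x ∈ closedBall (0 : EuclideanSpace ℝ (Fin k)) R, ψ x = 0)) := by
  obtain ⟨n, rfl⟩ : ∃ n, k = n + 1 := ⟨k - 1, by omega⟩
  have hp0 : 0 < p := by linarith
  have hψc : ContinuousOn ψ (closedBall 0 R) := hψ.continuousOn.mono hBU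
  have hgc : ContinuousOn (gradient ψ) (closedBall 0 R) :=
    (continuousOn_gradient_of_contDiffOn hU hψ).mono hBU
  have hψp : ContinuousOn (fun x => ψ x ^ p) (closedBall 0 R) :=
    hψc.rpow_const fun _ _ => Or.inr hp0.le
  have hkn : ((n + 1 : ℕ) : ℝ) - 1 = n := by push_cast; ring
  rw [hkn]
  push_cast at hγ ⊢
  set a : ℝ := n + 1 - γ with ha
  have ha0 : 0 < a := by linarith
  set c : ℝ := a / p with hc
  have hc0 : 0 < c := by positivity
  set I := ∫ x in ball (0 : EuclideanSpace ℝ (Fin (n + 1))) R, ψ x ^ p * ‖x‖ ^ (-γ) with hI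
  set J := ∫ x in ball (0 : EuclideanSpace ℝ (Fin (n + 1))) R,
    ‖gradient ψ x‖ ^ p * ‖x‖ ^ (p - γ) with hJ
  set B := ∫ x in sphere (0 : EuclideanSpace ℝ (Fin (n + 1))) R, ψ x ^ p ∂(μH[(n : ℝ)]) with hB
  set S := ∫ ω, ψ (R • (ω : EuclideanSpace ℝ (Fin (n + 1)))) ^ p
        ∂(volume : Measure (EuclideanSpace ℝ (Fin (n + 1)))).toSphere with hS
  have hSB : R ^ n * S ≤ B :=
    integral_toSphere_le_integral_hausdorffMeasure n hR (hψp.mono sphere_subset_closedBall)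
      fun x hx => rpow_nonneg (hpos x (hBU (sphere_subset_closedBall hx))) p
  have hne : ∀ᵐ x ∂(volume.restrict (ball (0 : EuclideanSpace ℝ (Fin (n + 1))) R)), x ≠ 0 :=
    ae_restrict_of_ae (by simp [ae_iff])
  let G : EuclideanSpace ℝ (Fin (n + 1)) → ℝ :=
    fun x => a * ψ x ^ p + p * ψ x ^ (p - 1) * inner ℝ (gradient ψ x) x
  let K : EuclideanSpace ℝ (Fin (n + 1)) → ℝ := fun x => (‖gradient ψ x‖ * ‖x‖) ^ p
  let H : EuclideanSpace ℝ (Fin (n + 1)) → ℝ :=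
    fun x => K x + c ^ (p - 1) * G x - c ^ p * ψ x ^ p
  have hGc : ContinuousOn G (closedBall 0 R) :=
    (continuousOn_const.mul hψp).add
      ((continuousOn_const.mul (hψc.rpow_const fun _ _ => Or.inr (by linarith))).mul
        (hgc.inner (𝕜 := ℝ) continuousOn_id))
  have hKc : ContinuousOn K (closedBall 0 R) :=
    (hgc.norm.mul continuousOn_id.norm).rpow_const fun _ _ => Or.inr hp0.le
  have hHc : ContinuousOn H (closedBall 0 R) :=
    (hKc.add (continuousOn_const.mul hGc)).sub (continuousOn_const.mul hψp)
  have hI' : ∫ x in ball (0 : EuclideanSpace ℝ (Fin (n + 1))) R, ‖x‖ ^ (-γ) * ψ x ^ p = I := by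
    simp only [hI, mul_comm]
  have hJ' : ∫ x in ball (0 : EuclideanSpace ℝ (Fin (n + 1))) R, ‖x‖ ^ (-γ) * K x = J := by
    refine integral_congr_ae ?_
    filter_upwards [hne] with x hx
    simp only [K]
    rw [mul_rpow (norm_nonneg _) (norm_nonneg _), sub_eq_add_neg, rpow_add (norm_pos_iff.2 hx)]
    ring
  have hG' : ∫ x in ball (0 : EuclideanSpace ℝ (Fin (n + 1))) R, ‖x‖ ^ (-γ) * G x = R ^ a * S :=
    integral_ball_radial_divergence hp hγ hR hU hBU hψ
  have hH' : ∫ x in ball (0 : EuclideanSpace ℝ (Fin (n + 1))) R, ‖x‖ ^ (-γ) * H x =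
      J + c ^ (p - 1) * (R ^ a * S) - c ^ p * I := by
    have hKi := integrableOn_norm_rpow_neg_mul hγ hKc
    have hGi := (integrableOn_norm_rpow_neg_mul hγ hGc).const_mul (c ^ (p - 1))
    have hIi := (integrableOn_norm_rpow_neg_mul hγ hψp).const_mul (c ^ p)
    rw [← hJ', ← hG', ← hI', ← integral_const_mul, ← integral_const_mul, ← integral_add hKi hGi,
      ← integral_sub (f := fun x => ‖x‖ ^ (-γ) * K x + c ^ (p - 1) * (‖x‖ ^ (-γ) * G x))
        (hKi.add hGi) hIi]
    refine integral_congr_ae (Filter.Eventually.of_forall fun x => ?_)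
    simp only [H]
    ring
  have hpt : ∀ x ∈ ball (0 : EuclideanSpace ℝ (Fin (n + 1))) R,
      0 ≤ H x ∧ (1 < p → H x = 0 → inner ℝ (gradient ψ x) x = -(c * ψ x)) := fun x hx =>
    hardy_pointwise_nonneg hp ha0 (hpos x (hBU (ball_subset_closedBall hx))) (by positivity)
      (abs_real_inner_le_norm _ _)
  have hHint0 : 0 ≤ J + c ^ (p - 1) * (R ^ a * S) - c ^ p * I := by
    rw [← hH']
    exact setIntegral_nonneg measurableSet_ball fun x hx =>
      mul_nonneg (rpow_nonneg (norm_nonneg _) _) (hpt x hx).1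
  have hRa : R ^ a = R ^ (1 - γ) * R ^ n := by
    rw [← rpow_natCast R n, ← rpow_add hR, ha]; ring_nf
  have hbd : c ^ (p - 1) * (R ^ a * S) ≤ c ^ (p - 1) * R ^ (1 - γ) * B := by
    rw [hRa, mul_assoc, mul_assoc]
    gcongr
  refine ⟨by linarith, fun hp1 => ⟨fun heq x hx => ?_, fun hzero => ?_⟩⟩
  · have hH0 : ∫ x in ball (0 : EuclideanSpace ℝ (Fin (n + 1))) R, ‖x‖ ^ (-γ) * H x = 0 := by
      rw [hH']; linarith
    rw [setIntegral_eq_zero_iff_of_nonneg_ae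
      (by filter_upwards [ae_restrict_mem measurableSet_ball] with x hx using
            mul_nonneg (rpow_nonneg (norm_nonneg _) _) (hpt x hx).1)
      (integrableOn_norm_rpow_neg_mul hγ hHc)] at hH0
    have hae : H =ᵐ[volume.restrict (ball (0 : EuclideanSpace ℝ (Fin (n + 1))) R)] fun _ => 0 := by
      filter_upwards [hH0, hne] with x hx hx0
      exact (mul_eq_zero.1 hx).resolve_left (rpow_pos_of_pos (norm_pos_iff.2 hx0) _).ne'
    have hall := Measure.eqOn_open_of_ae_eq hae isOpen_ball (hHc.mono ball_subset_closedBall)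
      continuousOn_const
    exact eq_zero_of_inner_gradient_eq_neg hR hc0 hU hBU hψ
      (fun y hy => (hpt y hy).2 hp1 (hall hy)) hx
  · have hI0 : I = 0 := by
      refine setIntegral_eq_zero_of_forall_eq_zero fun x hx => ?_
      simp [hzero x (ball_subset_closedBall hx), zero_rpow hp0.ne']
    have hJ0 : J = 0 := by
      refine setIntegral_eq_zero_of_forall_eq_zero fun x hx => ?_
      have hev : ψ =ᶠ[nhds x] fun _ => 0 := by
        filter_upwards [isOpen_ball.mem_nhds hx] with y hy using
          hzero y (ball_subset_closedBall hy)
      have : gradient ψ x = 0 := by rw [gradient, hev.fderiv_eq]; simp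
      simp [this, zero_rpow hp0.ne']
    have hB0 : B = 0 := by
      refine setIntegral_eq_zero_of_forall_eq_zero fun x hx => ?_
      simp [hzero x (sphere_subset_closedBall hx), zero_rpow hp0.ne']
    rw [hI0, hJ0, hB0]; simp
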